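/- The exact shift of the vertex-operator product μ₂ by the degree −1 map f₂ (with all parameters kᵢ = 1) yields exactly the C∞ product m₂ of Yang–Mills theory: for every ordered pair (u,v) of homogeneous elements of the kinematic complex with |u| + |v| ≤ 3, one has μ₂(u,v) + m₁(f₂(u,v)) + f₂(m₁u, v) + (−1)^{|u|} f₂(u, m₁v) = m₂(u,v), where m₂ is given by the explicit list below; in particular the shifted product m₂ is graded commutative, m₂(u,v) = (−1)^{|u||v|} m₂(v,u), for all homogeneous u,v. -/

import Mathlib

noncomputable section

/-- Points of ℝ^D. -/
abbrev Pt (D : ℕ) := Fin D → ℝ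
/-- Scalar fields on ℝ^D. -/
abbrev Fn (D : ℕ) := Pt D → ℝ
/-- Vector fields on ℝ^D (components carry a lower Lorentz index). -/
abbrev Vec (D : ℕ) := Pt D → Fin D → ℝ

/-- Diagonal entries of the Minkowski metric η = diag(−1,1,…,1) (η is its own inverse). -/
def eta (D : ℕ) (μ : Fin D) : ℝ := if (μ : ℕ) = 0 then -1 else 1

/-- Partial derivative ∂_μ. -/
def pd {D : ℕ} (μ : Fin D) (f : Fn D) : Fn D := fun x => fderiv ℝ f x (Pi.single μ 1)

/-- Minkowski pairing X·Y = η^{μν} X_μ Y_ν. -/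
def dot {D : ℕ} (X Y : Vec D) : Fn D := fun x => ∑ μ, eta D μ * X x μ * Y x μ

/-- Divergence ∂·X = ∂^μ X_μ. -/
def divg {D : ℕ} (X : Vec D) : Fn D := fun x => ∑ μ, eta D μ * pd μ (fun y => X y μ) x

/-- Gradient (∂f)_μ = ∂_μ f. -/
def grad {D : ℕ} (f : Fn D) : Vec D := fun x μ => pd μ f x

/-- Wave operator □ = ∂^μ∂_μ on scalars. -/
def box {D : ℕ} (f : Fn D) : Fn D := fun x => ∑ μ, eta D μ * pd μ (pd μ f) x

/-- Wave operator acting componentwise on vector fields. -/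
def boxV {D : ℕ} (X : Vec D) : Vec D := fun x μ => box (fun y => X y μ) x

/-- Generalized Lie derivative product: (X*Y)_μ = X^ν ∂_ν Y_μ + (∂_μ X_ν − ∂_ν X_μ) Y^ν. -/
def starP {D : ℕ} (X Y : Vec D) : Vec D := fun x μ =>
  ∑ ν, eta D ν * (X x ν * pd ν (fun y => Y y μ) x
    + (pd μ (fun y => X y ν) x - pd ν (fun y => X y μ) x) * Y x ν)

/-- Bullet product X•Y = (∂·X)Y − (∂·Y)X + X*Y − Y*X. -/
def bullet {D : ℕ} (X Y : Vec D) : Vec D :=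
  fun x μ => divg X x * Y x μ - divg Y x * X x μ + starP X Y x μ - starP Y X x μ

/-- Pointwise product of scalar fields. -/
def fmul {D : ℕ} (f g : Fn D) : Fn D := fun x => f x * g x

/-- Pointwise scaling of a vector field by a scalar field. -/
def fsmul {D : ℕ} (f : Fn D) (X : Vec D) : Vec D := fun x μ => f x * X x μ

/-- Smoothness of scalar fields. -/
def SmF {D : ℕ} (f : Fn D) : Prop := ContDiff ℝ (⊤ : ℕ∞) f

/-- Smoothness of vector fields. -/
def SmV {D : ℕ} (X : Vec D) : Prop := ∀ μ, ContDiff ℝ (⊤ : ℕ∞) fun x => X x μ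

/-- Differential m₁ : K₀ → K₁, λ ↦ (∂λ, □λ). -/
def m1₀ {D : ℕ} (l : Fn D) : Vec D × Fn D := (grad l, box l)

/-- Differential m₁ : K₁ → K₂, (A,φ) ↦ (□A − ∂φ, ∂·A − φ). -/
def m1₁ {D : ℕ} (a : Vec D × Fn D) : Vec D × Fn D :=
  (fun x μ => boxV a.1 x μ - grad a.2 x μ, fun x => divg a.1 x - a.2 x)

/-- Differential m₁ : K₂ → K₃, (E,e) ↦ □e − ∂·E. -/
def m1₂ {D : ℕ} (e : Vec D × Fn D) : Fn D := fun x => box e.2 x - divg e.1 x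

/-- μ₂ on K₀ ⊗ K₀. -/
def mu2₀₀ {D : ℕ} (l1 l2 : Fn D) : Fn D := fmul l1 l2

/-- μ₂ on K₀ ⊗ K₁: μ₂(λ,(A,φ)) = (λA, λφ). -/
def mu2₀₁ {D : ℕ} (l : Fn D) (a : Vec D × Fn D) : Vec D × Fn D := (fsmul l a.1, fmul l a.2)

/-- μ₂ on K₁ ⊗ K₀: μ₂((A,φ),λ) = (λA, λφ + 2A·∂λ). -/
def mu2₁₀ {D : ℕ} (a : Vec D × Fn D) (l : Fn D) : Vec D × Fn D :=
  (fsmul l a.1, fun x => l x * a.2 x + 2 * dot a.1 (grad l) x)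

/-- μ₂ on K₀ ⊗ K₂: μ₂(λ,(E,e)) = (λE, λe). -/
def mu2₀₂ {D : ℕ} (l : Fn D) (e : Vec D × Fn D) : Vec D × Fn D := (fsmul l e.1, fmul l e.2)

/-- μ₂ on K₂ ⊗ K₀: μ₂((E,e),λ) = μ₂(λ,(E,e)). -/
def mu2₂₀ {D : ℕ} (e : Vec D × Fn D) (l : Fn D) : Vec D × Fn D := (fsmul l e.1, fmul l e.2)

/-- μ₂ on K₁ ⊗ K₁: μ₂((A₁,φ₁),(A₂,φ₂)) = (φ₁A₂ − φ₂A₁ + 2A₁*A₂, A₁·A₂). -/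
def mu2₁₁ {D : ℕ} (a1 a2 : Vec D × Fn D) : Vec D × Fn D :=
  (fun x μ => a1.2 x * a2.1 x μ - a2.2 x * a1.1 x μ + 2 * starP a1.1 a2.1 x μ,
   dot a1.1 a2.1)

/-- μ₂ on K₁ ⊗ K₂: μ₂((A,φ),(E,e)) = −A·E + φe + 2A·∂e. -/
def mu2₁₂ {D : ℕ} (a e : Vec D × Fn D) : Fn D :=
  fun x => -(dot a.1 e.1 x) + a.2 x * e.2 x + 2 * dot a.1 (grad e.2) x

/-- μ₂ on K₂ ⊗ K₁: μ₂((E,e),(A,φ)) = μ₂((A,φ),(E,e)). -/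
def mu2₂₁ {D : ℕ} (e a : Vec D × Fn D) : Fn D := mu2₁₂ a e

/-- μ₂ on K₀ ⊗ K₃: μ₂(λ,N) = λN. -/
def mu2₀₃ {D : ℕ} (l N : Fn D) : Fn D := fmul l N

/-- μ₂ on K₃ ⊗ K₀: μ₂(N,λ) = λN. -/
def mu2₃₀ {D : ℕ} (N l : Fn D) : Fn D := fmul l N

/-- m₂ on K₀ ⊗ K₀. -/
def m2₀₀ {D : ℕ} (l1 l2 : Fn D) : Fn D := fmul l1 l2

/-- m₂ on K₀ ⊗ K₁: m₂(λ,(A,φ)) = (λA, ∂·(λA)). -/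
def m2₀₁ {D : ℕ} (l : Fn D) (a : Vec D × Fn D) : Vec D × Fn D :=
  (fsmul l a.1, divg (fsmul l a.1))

/-- m₂ on K₁ ⊗ K₀: m₂((A,φ),λ) = (λA, ∂·(λA)). -/
def m2₁₀ {D : ℕ} (a : Vec D × Fn D) (l : Fn D) : Vec D × Fn D :=
  (fsmul l a.1, divg (fsmul l a.1))

/-- m₂ on K₀ ⊗ K₂: m₂(λ,(E,e)) = (λ(E − ∂e), 0). -/
def m2₀₂ {D : ℕ} (l : Fn D) (e : Vec D × Fn D) : Vec D × Fn D :=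
  (fun x μ => l x * (e.1 x μ - grad e.2 x μ), 0)

/-- m₂ on K₂ ⊗ K₀: m₂((E,e),λ) = (λ(E − ∂e), 0). -/
def m2₂₀ {D : ℕ} (e : Vec D × Fn D) (l : Fn D) : Vec D × Fn D :=
  (fun x μ => l x * (e.1 x μ - grad e.2 x μ), 0)

/-- m₂ on K₁ ⊗ K₁: m₂((A₁,φ₁),(A₂,φ₂)) = (A₁•A₂, 0). -/
def m2₁₁ {D : ℕ} (a1 a2 : Vec D × Fn D) : Vec D × Fn D := (bullet a1.1 a2.1, 0)

/-- m₂ on K₁ ⊗ K₂: m₂((A,φ),(E,e)) = A·(∂e − E). -/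
def m2₁₂ {D : ℕ} (a e : Vec D × Fn D) : Fn D :=
  dot a.1 (fun x μ => grad e.2 x μ - e.1 x μ)

/-- m₂ on K₂ ⊗ K₁: m₂((E,e),(A,φ)) = A·(∂e − E). -/
def m2₂₁ {D : ℕ} (e a : Vec D × Fn D) : Fn D :=
  dot a.1 (fun x μ => grad e.2 x μ - e.1 x μ)

/-- m₂ on K₀ ⊗ K₃: m₂(λ,N) = λN. -/
def m2₀₃ {D : ℕ} (l N : Fn D) : Fn D := fmul l N

/-- m₂ on K₃ ⊗ K₀: m₂(N,λ) = λN. -/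
def m2₃₀ {D : ℕ} (N l : Fn D) : Fn D := fmul l N

/-- f₂ on K₁ ⊗ K₁: f₂((A₁,φ₁),(A₂,φ₂)) = (0, A₁·A₂) ∈ K₁. -/
def f2₁₁ {D : ℕ} (a1 a2 : Vec D × Fn D) : Vec D × Fn D := (0, dot a1.1 a2.1)

/-- f₂ on K₀ ⊗ K₂: f₂(λ,(E,e)) = (0, λe) ∈ K₁. -/
def f2₀₂ {D : ℕ} (l : Fn D) (e : Vec D × Fn D) : Vec D × Fn D := (0, fmul l e.2)

/-- f₂ on K₂ ⊗ K₀: f₂((E,e),λ) = (0, λe) ∈ K₁. -/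
def f2₂₀ {D : ℕ} (e : Vec D × Fn D) (l : Fn D) : Vec D × Fn D := (0, fmul l e.2)

/-- f₂ on K₁ ⊗ K₂: f₂((A,φ),(E,e)) = (eA, 0) ∈ K₂. -/
def f2₁₂ {D : ℕ} (a e : Vec D × Fn D) : Vec D × Fn D := (fsmul e.2 a.1, 0)

/-- f₂ on K₂ ⊗ K₁: f₂((E,e),(A,φ)) = (eA, 0) ∈ K₂. -/
def f2₂₁ {D : ℕ} (e a : Vec D × Fn D) : Vec D × Fn D := (fsmul e.2 a.1, 0)

/-- f₂ on K₂ ⊗ K₂: f₂((E₁,e₁),(E₂,e₂)) = e₁e₂ ∈ K₃. -/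
def f2₂₂ {D : ℕ} (e1 e2 : Vec D × Fn D) : Fn D := fmul e1.2 e2.2

section PartialDerivatives

variable {D : ℕ}

theorem SmF.differentiable {f : Fn D} (hf : SmF f) : Differentiable ℝ f :=
  ContDiff.differentiable hf (by simp)

theorem SmV.differentiable {X : Vec D} (hX : SmV X) (μ : Fin D) :
    Differentiable ℝ fun x => X x μ :=
  (hX μ).differentiable (by simp)

theorem pd_zero (μ : Fin D) (x : Pt D) : pd μ (fun _ => 0) x = 0 := by
  simp [pd]

theorem pd_mul (μ : Fin D) {f g : Fn D} (hf : Differentiable ℝ f) (hg : Differentiable ℝ g)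
    (x : Pt D) : pd μ (fun y => f y * g y) x = f x * pd μ g x + g x * pd μ f x := by
  simp [pd, fderiv_fun_mul (hf x) (hg x)]

theorem box_zero (x : Pt D) : box (fun _ => (0 : ℝ)) x = 0 := by
  have h (μ : Fin D) : pd μ (fun _ => (0 : ℝ)) = fun _ => 0 := funext (pd_zero μ)
  simp [box, h]

theorem boxV_zero (x : Pt D) (μ : Fin D) : boxV (0 : Vec D) x μ = 0 :=
  box_zero x

theorem divg_zero (x : Pt D) : divg (0 : Vec D) x = 0 := by
  simp [divg, pd_zero]

theorem dot_comm (X Y : Vec D) : dot X Y = dot Y X := by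
  funext x
  exact Finset.sum_congr rfl fun μ _ => by ring

theorem grad_fmul {f g : Fn D} (hf : Differentiable ℝ f) (hg : Differentiable ℝ g)
    (x : Pt D) (μ : Fin D) :
    grad (fmul f g) x μ = f x * grad g x μ + g x * grad f x μ :=
  pd_mul μ hf hg x

theorem divg_fsmul {f : Fn D} {X : Vec D} (hf : Differentiable ℝ f)
    (hX : ∀ μ, Differentiable ℝ fun x => X x μ) (x : Pt D) :
    divg (fsmul f X) x = f x * divg X x + dot X (grad f) x := by
  simp only [divg, fsmul, dot, grad, Finset.mul_sum, ← Finset.sum_add_distrib]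
  refine Finset.sum_congr rfl fun μ _ => ?_
  rw [pd_mul μ hf (hX μ)]
  ring

/-- The symmetrization of the product `*` is the gradient of the Minkowski pairing. -/
theorem grad_dot {X Y : Vec D} (hX : ∀ μ, Differentiable ℝ fun x => X x μ)
    (hY : ∀ μ, Differentiable ℝ fun x => Y x μ) (x : Pt D) (μ : Fin D) :
    grad (dot X Y) x μ = starP X Y x μ + starP Y X x μ := by
  have hsum : grad (dot X Y) x μ = ∑ ν, eta D ν * pd μ (fun y => X y ν * Y y ν) x := by
    have hXY (ν : Fin D) : DifferentiableAt ℝ (fun y => X y ν * Y y ν) x :=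
      ((hX ν).mul (hY ν)) x
    have hdot : dot X Y = fun y => ∑ ν, eta D ν * (X y ν * Y y ν) := by
      funext y
      simp only [dot, mul_assoc]
    simp only [hdot, grad, pd]
    rw [fderiv_fun_sum fun ν _ => (hXY ν).const_mul (eta D ν)]
    simp [fderiv_const_mul (hXY _)]
  rw [hsum]
  simp only [starP, ← Finset.sum_add_distrib]
  refine Finset.sum_congr rfl fun ν _ => ?_
  rw [pd_mul μ (hX ν) (hY ν)]
  ring

theorem dot_sub_right (X Y Z : Vec D) (x : Pt D) :
    dot X (fun y μ => Y y μ - Z y μ) x = dot X Y x - dot X Z x := by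
  simp only [dot, mul_sub, Finset.sum_sub_distrib]

end PartialDerivatives

section Shift

variable {D : ℕ}

theorem shift_zero_one {l : Fn D} {a : Vec D × Fn D} (hl : SmF l) (ha : SmV a.1) :
    mu2₀₁ l a + f2₁₁ (m1₀ l) a + f2₀₂ l (m1₁ a) = m2₀₁ l a := by
  refine Prod.ext ?_ ?_
  · simp [mu2₀₁, f2₁₁, f2₀₂, m2₀₁]
  · funext x
    simp only [mu2₀₁, f2₁₁, f2₀₂, m2₀₁, m1₀, m1₁, fmul, Prod.snd_add, Pi.add_apply,
      divg_fsmul hl.differentiable ha.differentiable, dot_comm (grad l)]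
    ring

theorem shift_one_zero {l : Fn D} {a : Vec D × Fn D} (hl : SmF l) (ha : SmV a.1) :
    mu2₁₀ a l + f2₂₀ (m1₁ a) l - f2₁₁ a (m1₀ l) = m2₁₀ a l := by
  refine Prod.ext ?_ ?_
  · simp [mu2₁₀, f2₁₁, f2₂₀, m2₁₀]
  · funext x
    simp only [mu2₁₀, f2₁₁, f2₂₀, m2₁₀, m1₀, m1₁, fmul, Prod.snd_add, Prod.snd_sub,
      Pi.add_apply, Pi.sub_apply, divg_fsmul hl.differentiable ha.differentiable]
    ring

theorem shift_zero_two {l : Fn D} {e : Vec D × Fn D} (hl : SmF l) (he : SmF e.2) :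
    mu2₀₂ l e + m1₁ (f2₀₂ l e) + f2₁₂ (m1₀ l) e = m2₀₂ l e := by
  refine Prod.ext ?_ ?_
  · funext x μ
    simp only [mu2₀₂, f2₀₂, f2₁₂, m2₀₂, m1₀, m1₁, fsmul, Prod.fst_add, Pi.add_apply,
      boxV_zero, grad_fmul hl.differentiable he.differentiable]
    ring
  · funext x
    simp [mu2₀₂, f2₀₂, f2₁₂, m2₀₂, m1₁, divg_zero]

theorem shift_one_one {a b : Vec D × Fn D} (ha : SmV a.1) (hb : SmV b.1) :
    mu2₁₁ a b + m1₁ (f2₁₁ a b) + f2₂₁ (m1₁ a) b - f2₁₂ a (m1₁ b) = m2₁₁ a b := by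
  refine Prod.ext ?_ ?_
  · funext x μ
    simp only [mu2₁₁, f2₁₁, f2₁₂, f2₂₁, m2₁₁, m1₁, fsmul, bullet, Prod.fst_add, Prod.fst_sub,
      Pi.add_apply, Pi.sub_apply, boxV_zero, grad_dot ha.differentiable hb.differentiable]
    ring
  · funext x
    simp [mu2₁₁, f2₁₁, f2₁₂, f2₂₁, m2₁₁, m1₁, divg_zero]

theorem shift_one_two {a e : Vec D × Fn D} (ha : SmV a.1) (he : SmF e.2) :
    mu2₁₂ a e + m1₂ (f2₁₂ a e) + f2₂₂ (m1₁ a) e = m2₁₂ a e := by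
  have hbox (x : Pt D) : box (0 : Fn D) x = 0 := box_zero x
  funext x
  simp only [mu2₁₂, f2₁₂, f2₂₂, m2₁₂, m1₁, m1₂, fmul, Pi.add_apply, hbox, dot_sub_right,
    divg_fsmul he.differentiable ha.differentiable]
  ring

theorem f2₂₂_comm (e e' : Vec D × Fn D) : f2₂₂ e e' = f2₂₂ e' e :=
  mul_comm e.2 e'.2

theorem m2₁₁_antisymm (a b : Vec D × Fn D) : m2₁₁ a b = -(m2₁₁ b a) := by
  refine Prod.ext ?_ ?_
  · funext x μ
    simp only [m2₁₁, bullet, Prod.fst_neg, Pi.neg_apply]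
    ring
  · simp [m2₁₁]

end Shift

/-- the exact shift of μ₂ by the degree −1 map f₂ (all parameters kᵢ = 1),
m₂(u,v) = μ₂(u,v) + m₁(f₂(u,v)) + f₂(m₁u,v) + (−1)^{|u|} f₂(u,m₁v), yields exactly the
C∞ product m₂ of Yang–Mills theory in every component with |u| + |v| ≤ 3 (components
of f₂ and m₁ landing beyond degree 3 are zero and are omitted); in particular m₂ is
graded commutative, m₂(u,v) = (−1)^{|u||v|} m₂(v,u). -/
theorem mu2_shift_by_f2_gives_m2 {D : ℕ} (hD : 1 ≤ D)
    (l l1 l2 : Fn D) (a a1 a2 e e1 e2 : Vec D × Fn D) (N : Fn D)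
    (hl : SmF l) (hl1 : SmF l1) (hl2 : SmF l2)
    (haV : SmV a.1) (haF : SmF a.2) (ha1V : SmV a1.1) (ha1F : SmF a1.2)
    (ha2V : SmV a2.1) (ha2F : SmF a2.2)
    (heV : SmV e.1) (heF : SmF e.2) (he1V : SmV e1.1) (he1F : SmF e1.2)
    (he2V : SmV e2.1) (he2F : SmF e2.2) (hN : SmF N) :
    -- (|u|,|v|) = (0,0)
    mu2₀₀ l1 l2 = m2₀₀ l1 l2 ∧
    -- (0,1)
    mu2₀₁ l a + f2₁₁ (m1₀ l) a + f2₀₂ l (m1₁ a) = m2₀₁ l a ∧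
    -- (1,0)
    mu2₁₀ a l + f2₂₀ (m1₁ a) l - f2₁₁ a (m1₀ l) = m2₁₀ a l ∧
    -- (0,2)
    mu2₀₂ l e + m1₁ (f2₀₂ l e) + f2₁₂ (m1₀ l) e = m2₀₂ l e ∧
    -- (2,0)
    mu2₂₀ e l + m1₁ (f2₂₀ e l) + f2₂₁ e (m1₀ l) = m2₂₀ e l ∧
    -- (1,1)
    mu2₁₁ a1 a2 + m1₁ (f2₁₁ a1 a2) + f2₂₁ (m1₁ a1) a2 - f2₁₂ a1 (m1₁ a2) = m2₁₁ a1 a2 ∧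
    -- (1,2)
    mu2₁₂ a e + m1₂ (f2₁₂ a e) + f2₂₂ (m1₁ a) e = m2₁₂ a e ∧
    -- (2,1)
    mu2₂₁ e a + m1₂ (f2₂₁ e a) + f2₂₂ e (m1₁ a) = m2₂₁ e a ∧
    -- (0,3)
    mu2₀₃ l N = m2₀₃ l N ∧
    -- (3,0)
    mu2₃₀ N l = m2₃₀ N l ∧
    -- graded commutativity of the shifted product m₂
    m2₀₀ l1 l2 = m2₀₀ l2 l1 ∧
    m2₀₁ l a = m2₁₀ a l ∧
    m2₀₂ l e = m2₂₀ e l ∧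
    m2₀₃ l N = m2₃₀ N l ∧
    m2₁₁ a1 a2 = -(m2₁₁ a2 a1) ∧
    m2₁₂ a e = m2₂₁ e a := by
  refine ⟨rfl, shift_zero_one hl haV, shift_one_zero hl haV, shift_zero_two hl heF,
    shift_zero_two hl heF, shift_one_one ha1V ha2V, shift_one_two haV heF, ?_, rfl, rfl,
    mul_comm l1 l2, rfl, rfl, rfl, m2₁₁_antisymm a1 a2, rfl⟩
  rw [f2₂₂_comm]
  exact shift_one_two haV heF
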